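/- In 𝒢 the identity (x y x^2)^{-1} = t_1 t_{12} t_8 t_5 t_1 holds. -/

import Mathlib

/-!
Symmetric generation of `M₂₂` (Hasan–Lim).  `G` is the quotient of the free
group on three generators `x, y, t` by the normal closure of the relators
`x^7, y^2, (xy)^3, [x,y]^4, t^2, [t^{x^2}, y x⁻¹], [t, y],
 (y t^{x^2})^5, (x y x^2 t^x)^5, (x t)^8`,
where `a ^ b := b⁻¹ a b` and `[a, b] := a⁻¹ b⁻¹ a b`.
-/

namespace M22

abbrev F := FreeGroup (Fin 3)
def fx : F := FreeGroup.of 0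
def fy : F := FreeGroup.of 1
def ft : F := FreeGroup.of 2

/-- conjugation `a ^ b = b⁻¹ * a * b` -/
def fconj (a b : F) : F := b⁻¹ * a * b
/-- commutator `[a, b] = a⁻¹ * b⁻¹ * a * b` -/
def fcomm (a b : F) : F := a⁻¹ * b⁻¹ * a * b

def rels : Set F :=
  {fx ^ 7, fy ^ 2, (fx * fy) ^ 3, (fcomm fx fy) ^ 4, ft ^ 2,
   fcomm (fconj ft (fx ^ 2)) (fy * fx⁻¹), fcomm ft fy,
   (fy * fconj ft (fx ^ 2)) ^ 5, (fx * fy * fx ^ 2 * fconj ft fx) ^ 5,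
   (fx * ft) ^ 8}

abbrev G := PresentedGroup rels

def x : G := PresentedGroup.of 0
def y : G := PresentedGroup.of 1
def t : G := PresentedGroup.of 2

/-- The symmetric generators `t₁, …, t₁₄`: for `1 ≤ i ≤ 7`, `tᵢ = t ^ (xⁱ)`,
and for `1 ≤ k ≤ 7`, `t₍₇₊ₖ₎ = t ^ (x⁵ y x^(k-1))`; the index is read modulo
`14` with representatives `1, …, 14`. -/
def tt (i : ℕ) : G :=
  let j := (i - 1) % 14 + 1
  if j ≤ 7 then (x ^ j)⁻¹ * t * x ^ j
  else (x ^ 5 * y * x ^ (j - 8))⁻¹ * t * (x ^ 5 * y * x ^ (j - 8))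

/-! ### Word identities in the control group `⟨x, y⟩` -/

section aux
variable {H : Type*} [Group H] {a b s : H}

lemma bab_eq (hb : b⁻¹ = b) (h3 : (a * b) ^ 3 = 1) : b * a * b = a⁻¹ * b * a⁻¹ := by
  have h : b * a * b = a⁻¹ * (a * b) ^ 3 * b⁻¹ * a⁻¹ := by simp [pow_succ, mul_assoc]
  rw [h, h3, hb, mul_one]

lemma bAb_eq (hb : b⁻¹ = b) (h3 : (a * b) ^ 3 = 1) : b * a⁻¹ * b = a * b * a := by
  have h := congrArg (·⁻¹) (bab_eq hb h3)
  simpa [mul_inv_rev, hb, mul_assoc] using h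

lemma a3b_pow (hb : b⁻¹ = b) (h3 : (a * b) ^ 3 = 1)
    (h4 : (a⁻¹ * b⁻¹ * a * b) ^ 4 = 1) : (a * b * a ^ 2) ^ 4 = 1 := by
  have e : a * b * a ^ 2 = (a⁻¹ * b⁻¹ * a * b)⁻¹ := by
    calc a * b * a ^ 2 = (a * b * a) * a := by simp [pow_succ, mul_assoc]
      _ = (b * a⁻¹ * b) * a := by rw [bAb_eq hb h3]
      _ = (a⁻¹ * b⁻¹ * a * b⁻¹⁻¹)⁻¹ := by simp [mul_assoc, hb]
      _ = _ := by rw [inv_inv]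
  rw [e, inv_pow, h4, inv_one]

lemma b3_eq (hb : b⁻¹ = b) (hn : (a * b * a ^ 2) ^ 4 = 1) :
    b * a ^ 3 * b * a ^ 3 * b = (a ^ 3)⁻¹ * b * (a ^ 3)⁻¹ := by
  have h : b * a ^ 3 * b * a ^ 3 * b
      = a⁻¹ * (a * b * a ^ 2) ^ 4 * (a ^ 2)⁻¹ * b⁻¹ * (a ^ 3)⁻¹ := by simp [pow_succ, mul_assoc]
  rw [h, hn, hb, mul_one]
  group

lemma word1 (hb : b⁻¹ = b) (h3 : (a * b) ^ 3 = 1)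
    (hn : (a * b * a ^ 2) ^ 4 = 1) :
    a ^ 6 * b * a ^ 2 =
      (a ^ 2 * b * (a ^ 3)⁻¹)⁻¹ * b * (a ^ 2 * b * (a ^ 3)⁻¹) * (a ^ 5 * b) := by
  have k : (b * a ^ 2 * b * (a ^ 2)⁻¹ * b * (a ^ 2)⁻¹ * b * a ^ 2 * b)
      = b * a ^ 3 * b * a ^ 3 * b * a ^ 3 * b := by
    calc _ = b * a ^ 2 * b * a⁻¹ * (a⁻¹ * b * a⁻¹) * a⁻¹ * b * a ^ 2 * b := by group
      _ = b * a ^ 2 * b * a⁻¹ * (b * a * b) * a⁻¹ * b * a ^ 2 * b := by rw [bab_eq hb h3]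
      _ = b * a ^ 2 * (b * a⁻¹ * b) * a * (b * a⁻¹ * b) * a ^ 2 * b := by group
      _ = b * a ^ 2 * (a * b * a) * a * (a * b * a) * a ^ 2 * b := by rw [bAb_eq hb h3]
      _ = _ := by simp [pow_succ, mul_assoc]
  have hbb : b * b = 1 := by nth_rewrite 1 [← hb]; exact inv_mul_cancel b
  have k2 : b * a ^ 3 * b * a ^ 3 * b * a ^ 3 * b = (a ^ 3)⁻¹ := by
    calc _ = (b * a ^ 3 * b * a ^ 3 * b) * a ^ 3 * b := by group
      _ = (a ^ 3)⁻¹ * b * (a ^ 3)⁻¹ * a ^ 3 * b := by rw [b3_eq hb hn]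
      _ = (a ^ 3)⁻¹ * (b * b) := by group
      _ = _ := by rw [hbb, mul_one]
  have k3 : b * a ^ 2 = (a ^ 3)⁻¹ * (b * (a ^ 2)⁻¹ * b * (a ^ 2)⁻¹ * b * a ^ 2 * b)⁻¹ := by
    rw [← k2, ← k]
    group
  calc a ^ 6 * b * a ^ 2 = a ^ 6 * (b * a ^ 2) := by group
    _ = a ^ 6 * ((a ^ 3)⁻¹ * (b * (a ^ 2)⁻¹ * b * (a ^ 2)⁻¹ * b * a ^ 2 * b)⁻¹) := by rw [k3]
    _ = a ^ 3 * b⁻¹ * (a ^ 2)⁻¹ * b⁻¹ * a ^ 2 * b⁻¹ * a ^ 2 * b⁻¹ := by group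
    _ = a ^ 3 * b⁻¹ * (a ^ 2)⁻¹ * b * a ^ 2 * b * a ^ 2 * b := by simp only [hb]
    _ = _ := by group

lemma word2 (ha : a ^ 7 = 1) (hb : b⁻¹ = b) (h3 : (a * b) ^ 3 = 1)
    (hn : (a * b * a ^ 2) ^ 4 = 1) :
    a ^ 5 * b * a * b * a ^ 2 = b * (a ^ 2 * b * (a ^ 3)⁻¹)⁻¹ * (a ^ 5 * b * a ^ 4) := by
  calc a ^ 5 * b * a * b * a ^ 2 = a ^ 5 * (b * a * b) * a ^ 2 := by group
    _ = a ^ 5 * (a⁻¹ * b * a⁻¹) * a ^ 2 := by rw [bab_eq hb h3]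
    _ = a ^ 7 * ((a ^ 3)⁻¹ * b * (a ^ 3)⁻¹) * a ^ 4 := by group
    _ = b * a ^ 3 * b * a ^ 3 * b * a ^ 4 := by rw [ha, one_mul, b3_eq hb hn]
    _ = b * a ^ 3 * b⁻¹ * a ^ 3 * b * a ^ 4 := by rw [hb]
    _ = _ := by group

lemma conj_eq_of_comm {g k w : H} (hg : Commute s g) (hw : w = g * k) :
    w⁻¹ * s * w = k⁻¹ * s * k := by
  have h : g⁻¹ * s * g = s := by rw [mul_assoc, hg.eq, inv_mul_cancel_left]
  calc w⁻¹ * s * w = k⁻¹ * (g⁻¹ * s * g) * k := by rw [hw]; group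
    _ = _ := by rw [h]

lemma comm_of_rel {g h : H} (e : g⁻¹ * h⁻¹ * g * h = 1) : Commute g h := by
  have : g * h = h * g * (g⁻¹ * h⁻¹ * g * h) := by group
  rw [e, mul_one] at this
  exact this

/-- Expanding `(n s)^5 = 1` when `n^4 = 1`. -/
lemma expand {n : H} (hn : n ^ 4 = 1) (h5 : (n * s) ^ 5 = 1) :
    n⁻¹ = s * (n⁻¹ * (n⁻¹ * (n⁻¹ * s * n) * n) * n) * (n⁻¹ * (n⁻¹ * s * n) * n)
      * (n⁻¹ * s * n) * s := by
  have h : s * (n⁻¹ * (n⁻¹ * (n⁻¹ * s * n) * n) * n) * (n⁻¹ * (n⁻¹ * s * n) * n)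
      * (n⁻¹ * s * n) * s = n⁻¹ * (n * s) * (n ^ 4)⁻¹ * (n * s) ^ 4 := by simp [pow_succ, mul_assoc]
  rw [h, hn, inv_one, mul_one, mul_assoc, ← pow_succ', h5, mul_one]

end aux

lemma rel_one {r : F} (h : r ∈ rels) : PresentedGroup.mk rels r = 1 :=
  PresentedGroup.one_of_mem h

lemma mk_x : PresentedGroup.mk rels fx = x := rfl
lemma mk_y : PresentedGroup.mk rels fy = y := rfl
lemma mk_t : PresentedGroup.mk rels ft = t := rfl

/-- `(x y x²)⁻¹ = t₁ t₁₂ t₈ t₅ t₁` in `G`. -/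
theorem xyx2_inv_eq :
    (x * y * x ^ 2)⁻¹ = tt 1 * tt 12 * tt 8 * tt 5 * tt 1 := by
  have r1 : x ^ 7 = 1 := by
    exact rel_one (r := fx ^ 7) (by simp [rels])
  have r2 : y ^ 2 = 1 := by
    exact rel_one (r := fy ^ 2) (by simp [rels])
  have r3 : (x * y) ^ 3 = 1 := by
    exact rel_one (r := (fx * fy) ^ 3) (by simp [rels])
  have r4 : (x⁻¹ * y⁻¹ * x * y) ^ 4 = 1 := by
    exact rel_one (r := (fcomm fx fy) ^ 4) (by simp [rels])
  have r6 : Commute ((x ^ 2)⁻¹ * t * x ^ 2) (y * x⁻¹) := by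
    apply comm_of_rel
    exact rel_one (r := fcomm (fconj ft (fx ^ 2)) (fy * fx⁻¹)) (by simp [rels])
  have r7 : Commute t y := by
    apply comm_of_rel
    exact rel_one (r := fcomm ft fy) (by simp [rels])
  have r9 : (x * y * x ^ 2 * (x⁻¹ * t * x)) ^ 5 = 1 := by
    exact rel_one (r := (fx * fy * fx ^ 2 * fconj ft fx) ^ 5) (by simp [rels])
  have hy : y⁻¹ = y := by
    rw [inv_eq_iff_mul_eq_one, ← sq, r2]
  have hn := a3b_pow hy r3 r4
  have hc : Commute t (x ^ 2 * y * (x ^ 3)⁻¹) := by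
    have e := congrArg (fun z => x ^ 2 * z * (x ^ 2)⁻¹) r6.eq
    have e1 : t * (x ^ 2 * y * (x ^ 3)⁻¹)
        = x ^ 2 * ((x ^ 2)⁻¹ * t * x ^ 2 * (y * x⁻¹)) * (x ^ 2)⁻¹ := by group
    have e2 : (x ^ 2 * y * (x ^ 3)⁻¹) * t
        = x ^ 2 * ((y * x⁻¹) * ((x ^ 2)⁻¹ * t * x ^ 2)) * (x ^ 2)⁻¹ := by group
    exact e1.trans (e.trans e2.symm)
  have t1 : tt 1 = x⁻¹ * t * x := by simp [tt]
  have t5 : tt 5 = (x ^ 5)⁻¹ * t * x ^ 5 := by simp [tt]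
  have t8 : tt 8 = (x ^ 5 * y)⁻¹ * t * (x ^ 5 * y) := by simp [tt]
  have t12 : tt 12 = (x ^ 5 * y * x ^ 4)⁻¹ * t * (x ^ 5 * y * x ^ 4) := by simp [tt]
  have c1 : (x * y * x ^ 2)⁻¹ * tt 1 * (x * y * x ^ 2) = tt 5 := by
    rw [t1, t5, ← conj_eq_of_comm (k := x ^ 5) (w := x ^ 2 * y * x ^ 2) hc (by group)]
    simp [pow_succ, mul_assoc]
  have c2 : (x * y * x ^ 2)⁻¹ * tt 5 * (x * y * x ^ 2) = tt 8 := by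
    rw [t5, t8, ← conj_eq_of_comm ((hc.inv_right.mul_right r7).mul_right hc)
      (word1 hy r3 hn)]
    group
  have c3 : (x * y * x ^ 2)⁻¹ * tt 8 * (x * y * x ^ 2) = tt 12 := by
    rw [t8, t12, ← conj_eq_of_comm (r7.mul_right hc.inv_right) (word2 r1 hy r3 hn)]
    group
  have key := expand hn r9
  rw [← t1, c1, c2, c3] at key
  exact key

end M22
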